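/- Let S^n be the space of n×n real symmetric matrices with the trace (Frobenius) inner product ⟨X, Y⟩ = tr(XY). Let K ⊆ S^n be a closed convex cone with U K Uᵀ ⊆ K for every n×n real orthogonal matrix U, and let H : S^n → S^n be an arbitrary map. If A solves the cone complementarity problem CP(H, K), i.e., A ∈ K, H(A) ∈ K*, and ⟨A, H(A)⟩ = 0, then A commutes with H(A): A · H(A) = H(A) · A. -/

import Mathlib

open Matrix

section ExpConjugation

attribute [local instance] Matrix.linftyOpNormedRing Matrix.linftyOpNormedAlgebra

variable {m : Type*} [Fintype m] [DecidableEq m]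

/-- The exponential of a skew-symmetric real matrix is orthogonal. -/
theorem Matrix.exp_mem_orthogonalGroup_of_transpose_eq_neg {S : Matrix m m ℝ} (hS : Sᵀ = -S) :
    NormedSpace.exp S ∈ Matrix.orthogonalGroup m ℝ := by
  rw [Matrix.mem_orthogonalGroup_iff, ← Matrix.exp_transpose, hS,
    ← Matrix.exp_add_of_commute _ _ (Commute.refl S).neg_right, add_neg_cancel,
    NormedSpace.exp_zero]

/-- The derivative at `0` of `t ↦ tr (B exp(tS) A exp(-tS))` is `tr (B (S A - A S))`. -/
theorem Matrix.hasDerivAt_trace_mul_exp_conj (A B S : Matrix m m ℝ) :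
    HasDerivAt (fun t : ℝ => (B * (NormedSpace.exp (t • S) * A * NormedSpace.exp (t • -S))).trace)
      (B * (S * A - A * S)).trace 0 := by
  have h₁ := hasDerivAt_exp_smul_const (𝕂 := ℝ) S (0 : ℝ)
  have h₂ := hasDerivAt_exp_smul_const (𝕂 := ℝ) (-S) (0 : ℝ)
  have h := ((h₁.mul_const A).mul h₂).const_mul B
  let tr := LinearMap.toContinuousLinearMap (Matrix.traceLinearMap m ℝ ℝ)
  refine (tr.hasFDerivAt.comp_hasDerivAt (0 : ℝ) h).congr_deriv ?_
  simp only [zero_smul, NormedSpace.exp_zero, one_mul, mul_one, mul_neg, ← sub_eq_add_neg]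
  rfl

end ExpConjugation

/-- A real symmetric matrix `A` that minimizes `X ↦ tr (B X)` over its orbit under orthogonal
conjugation commutes with the symmetric matrix `B`. -/
theorem Matrix.IsSymm.mul_comm_of_trace_le_conj {m : Type*} [Fintype m] [DecidableEq m]
    {A B : Matrix m m ℝ} (hA : A.IsSymm) (hB : B.IsSymm)
    (hmin : ∀ U ∈ Matrix.orthogonalGroup m ℝ, (B * A).trace ≤ (B * (U * A * Uᵀ)).trace) :
    A * B = B * A := by
  have hskew : (A * B - B * A)ᵀ = -(A * B - B * A) := by
    rw [transpose_sub, transpose_mul, transpose_mul, hA.eq, hB.eq, neg_sub]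
  set S := A * B - B * A
  have hderiv := Matrix.hasDerivAt_trace_mul_exp_conj A B S
  have hzero : (B * (S * A - A * S)).trace = 0 := by
    refine IsLocalMin.hasDerivAt_eq_zero (Filter.Eventually.of_forall fun t => ?_) hderiv
    have ht : (t • S)ᵀ = -(t • S) := by rw [transpose_smul, hskew, smul_neg]
    have h := hmin _ (Matrix.exp_mem_orthogonalGroup_of_transpose_eq_neg ht)
    rw [← Matrix.exp_transpose, ht, ← smul_neg] at h
    simpa using h
  have htrace : (Sᵀ * S).trace = 0 := by
    have h : (B * (S * A - A * S)).trace = (S * S).trace := by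
      have hSS : (S * S).trace = (A * B * S).trace - (B * A * S).trace := by
        rw [← trace_sub, ← sub_mul]
      rw [hSS, mul_sub, trace_sub, ← mul_assoc, ← mul_assoc, trace_mul_comm (B * S) A, ← mul_assoc]
    rw [hskew, neg_mul, trace_neg, ← h, hzero, neg_zero]
  have hS0 : S = 0 := by
    rw [← Matrix.conjTranspose_eq_transpose_of_trivial] at htrace
    exact Matrix.trace_conjTranspose_mul_self_eq_zero_iff.mp htrace
  exact sub_eq_zero.mp hS0

/-- **Corollary 1 of the paper, specialized to the algebra `Sⁿ` of real symmetric matrices**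
(with the trace inner product `⟨X, Y⟩ = tr (X Y)`). If `K ⊆ Sⁿ` is a closed convex cone
invariant under the automorphisms `X ↦ U X Uᵀ` (`U` orthogonal) and `A` solves the cone
complementarity problem `CP(H, K)` — that is, `A ∈ K`, `H(A) ∈ K*`, `⟨A, H(A)⟩ = 0` —
then `A` commutes with `H(A)`. -/
theorem cone_complementarity_commute_symm_matrices {n : ℕ}
    (K : Set (Matrix (Fin n) (Fin n) ℝ))
    (hKsymm : ∀ X ∈ K, X.IsSymm)
    (hKclosed : IsClosed K) (hKconv : Convex ℝ K)
    (hKcone : ∀ X ∈ K, ∀ c : ℝ, 0 < c → c • X ∈ K)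
    (hKinv : ∀ U ∈ Matrix.orthogonalGroup (Fin n) ℝ, ∀ X ∈ K, U * X * Uᵀ ∈ K)
    (H : Matrix (Fin n) (Fin n) ℝ → Matrix (Fin n) (Fin n) ℝ)
    (hHsymm : ∀ X : Matrix (Fin n) (Fin n) ℝ, X.IsSymm → (H X).IsSymm)
    (A : Matrix (Fin n) (Fin n) ℝ)
    (hA : A ∈ K)
    (hHA : ∀ X ∈ K, 0 ≤ (H A * X).trace)
    (hcomp : (A * H A).trace = 0) :
    A * H A = H A * A := by
  refine (hKsymm A hA).mul_comm_of_trace_le_conj (hHsymm A (hKsymm A hA)) fun U hU => ?_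
  rw [trace_mul_comm, hcomp]
  exact hHA _ (hKinv U hU A hA)
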